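/- arXiv:1112.1892 — 4 statements merged into one kernel-verified Lean document; each statement's English description precedes it below -/
import Mathlib

section
/- Assume the feasibility condition Σ_{l=1}^L γ_l M_l < |N|. Define, on the set of congestion profiles m with m_j < 1 for all j ∈ N, the potential V(m) = Σ_{j ∈ N} ( Σ_{l=1}^L γ_l m_{lj} log g_{lj} + ∫_0^{m_j} log(1/(1−x)) dx ). Then V is convex on this set, at least one Nash equilibrium exists, every Nash equilibrium m satisfies m_j < 1 for all j, and a congestion profile m with m_j < 1 for all j is a Nash equilibrium if and only if it minimizes V over the set of all congestion profiles with m_j < 1 for all j. -/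
open scoped BigOperators ENNReal

/-- `m` is a congestion profile: nonnegative entries, class `l` has total mass `Ml l`. -/
def IsProfile {L N : Type*} [Fintype N] (Ml : L → ℝ) (m : L → N → ℝ) : Prop :=
  (∀ l j, 0 ≤ m l j) ∧ ∀ l, (∑ j, m l j) = Ml l

/-- Congestion `m_j = ∑_l γ_l m_{lj}` at base station `j`. -/
noncomputable def cong {L N : Type*} [Fintype L] (γ : L → ℝ) (m : L → N → ℝ) (j : N) : ℝ :=
  ∑ l, γ l * m l j

/-- The constant `g_{lj} = γ_l σ² / h_{lj}`. -/
noncomputable def gq {L N : Type*} (σ2 : ℝ) (γ : L → ℝ) (h : L → N → ℝ) (l : L) (j : N) : ℝ :=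
  γ l * σ2 / h l j

/-- Cost density of class `l` at base station `j`: `g_{lj}/(1 − m_j)` if `m_j < 1`,
and `+∞` otherwise. -/
noncomputable def cd {L N : Type*} [Fintype L] (σ2 : ℝ) (γ : L → ℝ) (h : L → N → ℝ)
    (m : L → N → ℝ) (l : L) (j : N) : ℝ≥0∞ :=
  if cong γ m j < 1 then ENNReal.ofReal (gq σ2 γ h l j / (1 - cong γ m j)) else ⊤

/-- `m` is a Nash equilibrium of the nonatomic association game: whenever class `l` has
positive mass at base station `j`, `j` has minimal cost density for class `l`. -/
def IsNE {L N : Type*} [Fintype L] (σ2 : ℝ) (γ : L → ℝ) (h : L → N → ℝ)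
    (m : L → N → ℝ) : Prop :=
  ∀ (l : L) (j k : N), 0 < m l j → cd σ2 γ h m l j ≤ cd σ2 γ h m l k

/-- The potential `V(m) = ∑_j (∑_l γ_l m_{lj} log g_{lj} + ∫_0^{m_j} log(1/(1−x)) dx)`. -/
noncomputable def Vpot {L N : Type*} [Fintype L] [Fintype N]
    (σ2 : ℝ) (γ : L → ℝ) (h : L → N → ℝ) (m : L → N → ℝ) : ℝ :=
  ∑ j, ((∑ l, γ l * m l j * Real.log (gq σ2 γ h l j)) +
    ∫ x in (0:ℝ)..(cong γ m j), Real.log (1 / (1 - x)))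


noncomputable def Fpot (t : ℝ) : ℝ := (1 - t) * Real.log (1 - t) + t

theorem integral_Fpot (t : ℝ) :
    ∫ x in (0:ℝ)..t, Real.log (1 / (1 - x)) = Fpot t := by
  have h1 : ∀ x : ℝ, Real.log (1 / (1 - x)) = - Real.log (1 - x) := by
    intro x
    rw [one_div, Real.log_inv]
  simp only [h1]
  rw [intervalIntegral.integral_neg,
    intervalIntegral.integral_comp_sub_left (fun x => Real.log x) 1, integral_log]
  simp [Fpot]
  ring

theorem Vpot_eq {L N : Type*} [Fintype L] [Fintype N]
    (σ2 : ℝ) (γ : L → ℝ) (h : L → N → ℝ) (m : L → N → ℝ) :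
    Vpot σ2 γ h m = ∑ j, ((∑ l, γ l * m l j * Real.log (gq σ2 γ h l j)) +
      Fpot (cong γ m j)) := by
  simp only [Vpot, integral_Fpot]

theorem Fpot_sub (s t : ℝ) (hs : s ≤ 1) (ht : t < 1) :
    Fpot t + (-Real.log (1 - t)) * (s - t) ≤ Fpot s := by
  unfold Fpot
  have hv : 0 < 1 - t := by linarith
  rcases hs.eq_or_lt with rfl | hs
  · simp
    nlinarith
  · have hu : 0 < 1 - s := by linarith
    have := Real.log_le_sub_one_of_pos (div_pos hv hu)
    rw [Real.log_div hv.ne' hu.ne'] at this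
    have h2 := mul_le_mul_of_nonneg_left this hu.le
    have h3 : (1 - s) * ((1 - t) / (1 - s) - 1) = (1 - t) - (1 - s) := by
      field_simp
    rw [h3] at h2
    nlinarith

theorem Fpot_convex : ConvexOn ℝ (Set.Iio (1:ℝ)) Fpot := by
  refine ⟨convex_Iio 1, ?_⟩
  intro x hx y hy a b ha hb hab
  have hz : a • x + b • y ∈ Set.Iio (1:ℝ) := convex_Iio 1 hx hy ha hb hab
  have h1 := Fpot_sub x _ (le_of_lt hx) hz
  have h2 := Fpot_sub y _ (le_of_lt hy) hz
  have h1 := mul_le_mul_of_nonneg_left h1 ha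
  have h2 := mul_le_mul_of_nonneg_left h2 hb
  simp only [smul_eq_mul] at *
  generalize Real.log (1 - (a * x + b * y)) = w at *
  generalize Fpot (a * x + b * y) = f at *
  obtain rfl : b = 1 - a := by linarith
  nlinarith

theorem Fpot_continuous : Continuous Fpot := by
  have := Real.continuous_mul_log.comp (continuous_const.sub continuous_id : Continuous fun t : ℝ => 1 - t)
  exact this.add continuous_id

section
variable {L N : Type*} [Fintype L] [Fintype N]

theorem cong_comb (γ : L → ℝ) (m m' : L → N → ℝ) (a b : ℝ) (j : N) :
    cong γ (a • m + b • m') j = a * cong γ m j + b * cong γ m' j := by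
  simp only [cong, Finset.mul_sum, ← Finset.sum_add_distrib]
  refine Finset.sum_congr rfl fun l _ => ?_
  simp
  ring

theorem cong_nonneg' (γ : L → ℝ) (hγ : ∀ l, 0 < γ l) (Ml : L → ℝ) (m : L → N → ℝ)
    (hm : IsProfile Ml m) (j : N) : 0 ≤ cong γ m j :=
  Finset.sum_nonneg fun l _ => mul_nonneg (hγ l).le (hm.1 l j)

theorem cong_sum (γ : L → ℝ) (Ml : L → ℝ) (m : L → N → ℝ)
    (hm : IsProfile Ml m) : ∑ j, cong γ m j = ∑ l, γ l * Ml l := by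
  simp only [cong]
  rw [Finset.sum_comm]
  refine Finset.sum_congr rfl fun l _ => ?_
  rw [← Finset.mul_sum, hm.2]

theorem exists_lt_one (γ : L → ℝ) (Ml : L → ℝ) (m : L → N → ℝ)
    (hm : IsProfile Ml m) (hfeas : (∑ l, γ l * Ml l) < Fintype.card N) :
    ∃ k, cong γ m k < 1 := by
  by_contra! hc
  have : ∑ _j : N, (1:ℝ) ≤ ∑ j, cong γ m j := Finset.sum_le_sum fun j _ => hc j
  rw [cong_sum γ Ml m hm] at this
  simp at this
  linarith

theorem exists_pos_of_one_le (γ : L → ℝ) (hγ : ∀ l, 0 < γ l) (m : L → N → ℝ) (j : N)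
    (hj : 1 ≤ cong γ m j) : ∃ l, 0 < m l j := by
  by_contra! hc
  have : cong γ m j ≤ 0 := Finset.sum_nonpos fun l _ =>
    mul_nonpos_of_nonneg_of_nonpos (hγ l).le (hc l)
  linarith

theorem V_convex (σ2 : ℝ) (γ Ml : L → ℝ) (h : L → N → ℝ) :
    ConvexOn ℝ {m : L → N → ℝ | IsProfile Ml m ∧ ∀ j, cong γ m j < 1} (Vpot σ2 γ h) := by
  constructor
  · rintro x ⟨hx, hx1⟩ y ⟨hy, hy1⟩ a b ha hb hab
    refine ⟨⟨fun l j => ?_, fun l => ?_⟩, fun j => ?_⟩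
    · have := hx.1 l j
      have := hy.1 l j
      simp
      positivity
    · simp [Finset.sum_add_distrib, ← Finset.mul_sum, hx.2, hy.2]
      rw [← add_mul, hab, one_mul]
    · rw [cong_comb]
      exact convex_Iio (1:ℝ) (hx1 j) (hy1 j) ha hb hab
  · rintro x ⟨hx, hx1⟩ y ⟨hy, hy1⟩ a b ha hb hab
    simp only [Vpot_eq, smul_eq_mul, Finset.mul_sum, ← Finset.sum_add_distrib]
    refine Finset.sum_le_sum fun j _ => ?_
    rw [cong_comb]
    have h1 := Fpot_convex.2 (hx1 j) (hy1 j) ha hb hab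
    simp only [smul_eq_mul] at h1
    have h2 : (∑ l, γ l * (a • x + b • y) l j * Real.log (gq σ2 γ h l j)) =
        a * (∑ l, γ l * x l j * Real.log (gq σ2 γ h l j)) +
        b * (∑ l, γ l * y l j * Real.log (gq σ2 γ h l j)) := by
      simp only [Finset.mul_sum, ← Finset.sum_add_distrib]
      refine Finset.sum_congr rfl fun l _ => ?_
      simp
      ring
    rw [h2]
    linarith

theorem V_sub (σ2 : ℝ) (γ : L → ℝ) (h : L → N → ℝ) (m m' : L → N → ℝ)
    (hc : ∀ j, cong γ m j = cong γ m' j ∨ (cong γ m j < 1 ∧ cong γ m' j ≤ 1)) :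
    ∑ l, γ l * ∑ j, (m' l j - m l j) * (Real.log (gq σ2 γ h l j) - Real.log (1 - cong γ m j))
      ≤ Vpot σ2 γ h m' - Vpot σ2 γ h m := by
  simp only [Vpot_eq, Finset.mul_sum]
  rw [Finset.sum_comm, ← Finset.sum_sub_distrib]
  refine Finset.sum_le_sum fun j _ => ?_
  have h1 : Fpot (cong γ m j) + (-Real.log (1 - cong γ m j)) * (cong γ m' j - cong γ m j)
      ≤ Fpot (cong γ m' j) := by
    rcases hc j with e | ⟨e1, e2⟩
    · rw [e]; simp
    · exact Fpot_sub _ _ e2 e1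
  have h2 : ∑ l, γ l * ((m' l j - m l j) *
      (Real.log (gq σ2 γ h l j) - Real.log (1 - cong γ m j))) =
      (∑ l, γ l * m' l j * Real.log (gq σ2 γ h l j)) -
      (∑ l, γ l * m l j * Real.log (gq σ2 γ h l j)) +
      (-Real.log (1 - cong γ m j)) * (cong γ m' j - cong γ m j) := by
    generalize Real.log (1 - cong γ m j) = w
    simp only [cong, ← Finset.sum_sub_distrib, Finset.mul_sum, ← Finset.sum_add_distrib]
    refine Finset.sum_congr rfl fun l _ => ?_
    ring
  rw [h2]
  linarith

theorem gq_pos (σ2 : ℝ) (hσ : 0 < σ2) (γ : L → ℝ) (hγ : ∀ l, 0 < γ l)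
    (h : L → N → ℝ) (hh : ∀ l j, 0 < h l j) (l : L) (j : N) : 0 < gq σ2 γ h l j :=
  div_pos (mul_pos (hγ l) hσ) (hh l j)

theorem cd_le_iff (σ2 : ℝ) (hσ : 0 < σ2) (γ : L → ℝ) (hγ : ∀ l, 0 < γ l)
    (h : L → N → ℝ) (hh : ∀ l j, 0 < h l j) (m : L → N → ℝ) (l : L) (j k : N)
    (hj : cong γ m j < 1) (hk : cong γ m k < 1) :
    cd σ2 γ h m l j ≤ cd σ2 γ h m l k ↔
      gq σ2 γ h l j * (1 - cong γ m k) ≤ gq σ2 γ h l k * (1 - cong γ m j) := by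
  have hgk := gq_pos σ2 hσ γ hγ h hh l k
  have a : 0 < 1 - cong γ m j := by linarith
  have b : 0 < 1 - cong γ m k := by linarith
  simp only [cd, if_pos hj, if_pos hk]
  rw [ENNReal.ofReal_le_ofReal_iff (by positivity), div_le_div_iff₀ a b]

theorem NE_imp_min (σ2 : ℝ) (hσ : 0 < σ2) (γ Ml : L → ℝ) (hγ : ∀ l, 0 < γ l)
    (h : L → N → ℝ) (hh : ∀ l j, 0 < h l j) (m : L → N → ℝ) (hm : IsProfile Ml m)
    (hm1 : ∀ j, cong γ m j < 1) (hN : IsNE σ2 γ h m) (m' : L → N → ℝ) (hm' : IsProfile Ml m')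
    (hm1' : ∀ j, cong γ m' j < 1) : Vpot σ2 γ h m ≤ Vpot σ2 γ h m' := by
  have h0 := V_sub σ2 γ h m m' fun j => Or.inr ⟨hm1 j, (hm1' j).le⟩
  suffices hs : 0 ≤ ∑ l, γ l * ∑ j, (m' l j - m l j) *
      (Real.log (gq σ2 γ h l j) - Real.log (1 - cong γ m j)) by linarith
  refine Finset.sum_nonneg fun l _ => mul_nonneg (hγ l).le ?_
  set w : N → ℝ := fun j => Real.log (gq σ2 γ h l j) - Real.log (1 - cong γ m j) with hw
  have hmin : ∀ j k, 0 < m l j → w j ≤ w k := by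
    intro j k hp
    have h1 := (cd_le_iff σ2 hσ γ hγ h hh m l j k (hm1 j) (hm1 k)).1 (hN l j k hp)
    have hgj := gq_pos σ2 hσ γ hγ h hh l j
    have hgk := gq_pos σ2 hσ γ hγ h hh l k
    have a : 0 < 1 - cong γ m j := by linarith [hm1 j]
    have b : 0 < 1 - cong γ m k := by linarith [hm1 k]
    have h2 := Real.log_le_log (mul_pos hgj b) h1
    rw [Real.log_mul hgj.ne' b.ne', Real.log_mul hgk.ne' a.ne'] at h2
    simp only [hw]
    linarith
  change 0 ≤ ∑ j, (m' l j - m l j) * w j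
  by_cases hN' : Nonempty N
  · obtain ⟨j0, hj0⟩ := Finite.exists_min w
    have e : ∑ j, (m' l j - m l j) * w j0 = 0 := by
      rw [← Finset.sum_mul, Finset.sum_sub_distrib, hm.2, hm'.2]; simp
    rw [← e]
    refine Finset.sum_le_sum fun j _ => ?_
    rcases (hm.1 l j).eq_or_lt with e0 | hp
    · rw [← e0, sub_zero]
      exact mul_le_mul_of_nonneg_left (hj0 j) (hm'.1 l j)
    · rw [le_antisymm (hmin j j0 hp) (hj0 j)]
  · have := not_nonempty_iff.1 hN'
    simp

theorem min_imp (σ2 : ℝ) (hσ : 0 < σ2) (γ Ml : L → ℝ) (hγ : ∀ l, 0 < γ l)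
    (h : L → N → ℝ) (hh : ∀ l j, 0 < h l j) (m : L → N → ℝ) (hm : IsProfile Ml m)
    (hm1 : ∀ j, cong γ m j ≤ 1)
    (hmin : ∀ m', IsProfile Ml m' → (∀ j, cong γ m' j ≤ 1) →
      (∀ j, cong γ m j < 1 → cong γ m' j < 1) → Vpot σ2 γ h m ≤ Vpot σ2 γ h m')
    (l : L) (j k : N) (hp : 0 < m l j) (hk : cong γ m k < 1) :
    gq σ2 γ h l j * (1 - cong γ m k) ≤ gq σ2 γ h l k * (1 - cong γ m j) := by
  classical
  rcases eq_or_ne j k with rfl | hjk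
  · exact le_rfl
  have hgj := gq_pos σ2 hσ γ hγ h hh l j
  have hgk := gq_pos σ2 hσ γ hγ h hh l k
  have hgl := hγ l
  have key : ∀ ε : ℝ, 0 < ε → ε < m l j → γ l * ε < 1 - cong γ m k →
      gq σ2 γ h l j * (1 - cong γ m k - γ l * ε) ≤
        gq σ2 γ h l k * (1 - cong γ m j + γ l * ε) := by
    intro ε hε hε1 hε2
    have hδ : 0 < γ l * ε := by positivity
    set d : N → ℝ := fun i => (if i = k then ε else 0) - (if i = j then ε else 0) with hd
    have dk : d k = ε := by simp [hd, hjk.symm]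
    have dj : d j = -ε := by simp [hd, hjk]
    have d0 : ∀ i, i ≠ j → i ≠ k → d i = 0 := by
      intro i h1 h2
      simp [hd, h1, h2]
    set m' : L → N → ℝ := fun a i => m a i + (if a = l then d i else 0) with hm'
    have hcong : ∀ i, cong γ m' i = cong γ m i + γ l * d i := by
      intro i
      simp [cong, hm', mul_add, Finset.sum_add_distrib]
    have hprof : IsProfile Ml m' := by
      constructor
      · intro a i
        have h0 := hm.1 a i
        by_cases ha : a = l
        · subst ha
          simp only [hm', if_true]
          by_cases hij : i = j
          · rw [hij, dj]; linarith
          · by_cases hik : i = k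
            · rw [hik] at h0 ⊢; rw [dk]; linarith
            · rw [d0 i hij hik]; linarith
        · simpa [hm', ha] using h0
      · intro a
        simp only [hm', Finset.sum_add_distrib, hm.2]
        by_cases ha : a = l
        · simp [ha, hd, Finset.sum_sub_distrib]
        · simp [ha]
    have hcc : ∀ i, cong γ m' i = cong γ m i ∨ cong γ m' i < 1 := by
      intro i
      rw [hcong]
      by_cases hij : i = j
      · right; rw [hij, dj]; linarith [hm1 j]
      · by_cases hik : i = k
        · right; rw [hik, dk]; linarith
        · left; rw [d0 i hij hik]; ring
    have hV := hmin m' hprof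
      (fun i => by rcases hcc i with e | e; exacts [e ▸ hm1 i, e.le])
      (fun i hi => by rcases hcc i with e | e; exacts [e ▸ hi, e])
    have hS := V_sub σ2 γ h m' m (fun i => (hcc i).imp id fun e => ⟨e, hm1 i⟩)
    have hsum : ∑ a, γ a * ∑ i, (m a i - m' a i) *
        (Real.log (gq σ2 γ h a i) - Real.log (1 - cong γ m' i)) =
        γ l * ε * ((Real.log (gq σ2 γ h l j) - Real.log (1 - cong γ m' j)) -
          (Real.log (gq σ2 γ h l k) - Real.log (1 - cong γ m' k))) := by
      rw [Finset.sum_eq_single l]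
      · generalize (fun i => Real.log (gq σ2 γ h l i) - Real.log (1 - cong γ m' i)) = w at *
        have e : ∀ i, m l i - m' l i = (if i = j then ε else 0) - (if i = k then ε else 0) := by
          intro i
          simp [hm', hd]
        simp [e, sub_mul, Finset.sum_sub_distrib]
        ring
      · intro a _ ha
        simp [hm', ha]
      · simp
    rw [hsum] at hS
    have hS' : (Real.log (gq σ2 γ h l j) - Real.log (1 - cong γ m' j)) -
          (Real.log (gq σ2 γ h l k) - Real.log (1 - cong γ m' k)) ≤ 0 := by
      by_contra! hc
      have := mul_pos hδ hc
      linarith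
    rw [hcong, hcong, dj, dk] at hS'
    have a : 0 < 1 - cong γ m j + γ l * ε := by linarith [hm1 j]
    have b : 0 < 1 - cong γ m k - γ l * ε := by linarith
    rw [← Real.log_le_log_iff (mul_pos hgj b) (mul_pos hgk a),
      Real.log_mul hgj.ne' b.ne', Real.log_mul hgk.ne' a.ne']
    have e1 : 1 - (cong γ m j + γ l * -ε) = 1 - cong γ m j + γ l * ε := by ring
    have e2 : 1 - (cong γ m k + γ l * ε) = 1 - cong γ m k - γ l * ε := by ring
    rw [e1, e2] at hS'
    linarith
  by_contra! hc
  set A := gq σ2 γ h l j * (1 - cong γ m k)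
  set B := gq σ2 γ h l k * (1 - cong γ m j)
  set G := (gq σ2 γ h l j + gq σ2 γ h l k) * γ l with hG
  have hGp : 0 < G := by positivity
  obtain ⟨ε, hε, hlt⟩ := exists_between (a₁ := (0:ℝ))
    (a₂ := min (m l j) (min ((1 - cong γ m k) / γ l) ((A - B) / G)))
    (lt_min hp (lt_min (div_pos (by linarith) hgl) (div_pos (by linarith) hGp)))
  rw [lt_min_iff, lt_min_iff, lt_div_iff₀ hgl, lt_div_iff₀ hGp] at hlt
  obtain ⟨h1, h2, h3⟩ := hlt
  have := key ε hε h1 (by linarith)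
  simp only [A, B, G] at *
  nlinarith

theorem exists_closed_min (σ2 : ℝ) (γ Ml : L → ℝ) (hγ : ∀ l, 0 < γ l) (hMl : ∀ l, 0 < Ml l)
    (h : L → N → ℝ) (hfeas : (∑ l, γ l * Ml l) < Fintype.card N) :
    ∃ m, IsProfile Ml m ∧ (∀ j, cong γ m j ≤ 1) ∧
      ∀ m', IsProfile Ml m' → (∀ j, cong γ m' j ≤ 1) → Vpot σ2 γ h m ≤ Vpot σ2 γ h m' := by
  have hcc : ∀ j, Continuous fun m : L → N → ℝ => cong γ m j := by
    intro j
    unfold cong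
    fun_prop
  have hcV : Continuous (Vpot σ2 γ h) := by
    have e : Vpot σ2 γ h = fun m => ∑ j, ((∑ l, γ l * m l j * Real.log (gq σ2 γ h l j)) +
      Fpot (cong γ m j)) := funext fun m => Vpot_eq σ2 γ h m
    rw [e]
    refine continuous_finsetSum _ fun j _ => Continuous.add (by fun_prop) ?_
    exact Fpot_continuous.comp (hcc j)
  set S : Set (L → N → ℝ) := {m | IsProfile Ml m ∧ ∀ j, cong γ m j ≤ 1} with hS
  have hSc : IsClosed S := by
    have : S = (⋂ l, ⋂ j, {m : L → N → ℝ | 0 ≤ m l j}) ∩ (⋂ l, {m : L → N → ℝ | ∑ j, m l j = Ml l}) ∩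
        ⋂ j, {m : L → N → ℝ | cong γ m j ≤ 1} := by
      ext m
      simp [hS, IsProfile]
    rw [this]
    refine IsClosed.inter (IsClosed.inter ?_ ?_) ?_
    · exact isClosed_iInter fun l => isClosed_iInter fun j =>
        isClosed_le (by fun_prop) (by fun_prop)
    · exact isClosed_iInter fun l => isClosed_eq (by fun_prop) (by fun_prop)
    · exact isClosed_iInter fun j => isClosed_le (hcc j) continuous_const
  have hSk : IsCompact S := by
    refine IsCompact.of_isClosed_subset
      (isCompact_Icc (a := fun _ _ => (0:ℝ)) (b := fun (l : L) (_ : N) => Ml l)) hSc ?_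
    rintro m ⟨hm, -⟩
    refine ⟨fun l j => hm.1 l j, fun l j => ?_⟩
    change m l j ≤ Ml l
    rw [← hm.2 l]
    exact Finset.single_le_sum (f := fun j => m l j) (fun i _ => hm.1 l i) (Finset.mem_univ j)
  have hcard : (0:ℝ) < Fintype.card N :=
    lt_of_le_of_lt (Finset.sum_nonneg fun l _ => (mul_pos (hγ l) (hMl l)).le) hfeas
  have hne : S.Nonempty := by
    refine ⟨fun l _ => Ml l / Fintype.card N, ⟨fun l j => (div_pos (hMl l) hcard).le, fun l => ?_⟩,
      fun j => ?_⟩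
    · simp
      field_simp
    · simp only [cong, ← mul_div_assoc]
      rw [← Finset.sum_div, div_le_one hcard]
      exact hfeas.le
  obtain ⟨m, hm, hmm⟩ := hSk.exists_isMinOn hne hcV.continuousOn
  exact ⟨m, hm.1, hm.2, fun m' h1 h2 => hmm ⟨h1, h2⟩⟩

end

/-- Under feasibility `∑_l γ_l M_l < |N|`: the potential `V` is convex on the region of
congestion profiles with `m_j < 1` for all `j`, a Nash equilibrium exists, every Nash
equilibrium lies in this region, and a profile in this region is a Nash equilibrium iff
it minimizes `V` over the region. -/
theorem nonatomic_potential_game {L N : Type*} [Fintype L] [Fintype N]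
    (σ2 : ℝ) (hσ : 0 < σ2) (γ Ml : L → ℝ) (hγ : ∀ l, 0 < γ l) (hMl : ∀ l, 0 < Ml l)
    (h : L → N → ℝ) (hh : ∀ l j, 0 < h l j)
    (hfeas : (∑ l, γ l * Ml l) < Fintype.card N) :
    ConvexOn ℝ {m : L → N → ℝ | IsProfile Ml m ∧ ∀ j, cong γ m j < 1} (Vpot σ2 γ h) ∧
    (∃ m : L → N → ℝ, IsProfile Ml m ∧ IsNE σ2 γ h m) ∧
    (∀ m : L → N → ℝ, IsProfile Ml m → IsNE σ2 γ h m → ∀ j, cong γ m j < 1) ∧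
    (∀ m : L → N → ℝ, IsProfile Ml m → (∀ j, cong γ m j < 1) →
      (IsNE σ2 γ h m ↔
        ∀ m' : L → N → ℝ, IsProfile Ml m' → (∀ j, cong γ m' j < 1) →
          Vpot σ2 γ h m ≤ Vpot σ2 γ h m')) := by
  refine ⟨V_convex σ2 γ Ml h, ?_, ?_, ?_⟩
  · obtain ⟨m, hm, hm1, hmin⟩ := exists_closed_min σ2 γ Ml hγ hMl h hfeas
    have key := min_imp σ2 hσ γ Ml hγ h hh m hm hm1 (fun m' a b _ => hmin m' a b)
    have hlt : ∀ j, cong γ m j < 1 := by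
      intro j
      by_contra! hj
      obtain ⟨l, hl⟩ := exists_pos_of_one_le γ hγ m j hj
      obtain ⟨k, hk⟩ := exists_lt_one γ Ml m hm hfeas
      have h1 := key l j k hl hk
      rw [le_antisymm (hm1 j) hj] at h1
      have h2 := mul_pos (gq_pos σ2 hσ γ hγ h hh l j) (sub_pos.2 hk)
      simp at h1
      linarith
    exact ⟨m, hm, fun l j k hp =>
      (cd_le_iff σ2 hσ γ hγ h hh m l j k (hlt j) (hlt k)).2 (key l j k hp (hlt k))⟩
  · intro m hm hN j
    by_contra! hj
    obtain ⟨l, hl⟩ := exists_pos_of_one_le γ hγ m j hj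
    obtain ⟨k, hk⟩ := exists_lt_one γ Ml m hm hfeas
    have h1 := hN l j k hl
    simp [cd, hk, not_lt.2 hj] at h1
  · intro m hm hm1
    refine ⟨fun hN m' a b => NE_imp_min σ2 hσ γ Ml hγ h hh m hm hm1 hN m' a b, fun hmin => ?_⟩
    intro l j k hp
    rw [cd_le_iff σ2 hσ γ hγ h hh m l j k (hm1 j) (hm1 k)]
    exact min_imp σ2 hσ γ Ml hγ h hh m hm (fun i => (hm1 i).le)
      (fun m' a _ c => hmin m' a fun i => c i (hm1 i)) l j k hp (hm1 k)
end

section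
/- Assume Σ_{l=1}^L γ_l M_l < |N|. If m and m' are both Nash equilibria of the nonatomic base station association game, then the congestion at each base station is the same: m_j = m'_j for every j ∈ N (where m_j = Σ_l γ_l m_{lj}). Consequently, for each class l, the equilibrium cost density of class l is the same at m and m': for any j with m_{lj} > 0 and any k with m'_{lk} > 0, c_{lj}(m) = c_{lk}(m'). -/
open scoped BigOperators ENNReal

theorem aux_sum_cong {L N : Type*} [Fintype L] [Fintype N] (γ Ml : L → ℝ) (m : L → N → ℝ)
    (hm : IsProfile Ml m) : ∑ j, cong γ m j = ∑ l, γ l * Ml l := by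
  unfold cong
  rw [Finset.sum_comm]
  refine Finset.sum_congr rfl fun l _ => ?_
  rw [← Finset.mul_sum, hm.2 l]

theorem aux_lt_one {L N : Type*} [Fintype L] [Fintype N]
    (σ2 : ℝ) (γ Ml : L → ℝ) (h : L → N → ℝ)
    (hfeas : (∑ l, γ l * Ml l) < Fintype.card N)
    (m : L → N → ℝ) (hm : IsProfile Ml m) (hNE : IsNE σ2 γ h m) (j : N) :
    cong γ m j < 1 := by
  by_contra hj
  have hk : ∃ k, cong γ m k < 1 := by
    by_contra! hc
    have h1 : ∑ _k : N, (1 : ℝ) ≤ ∑ k, cong γ m k := Finset.sum_le_sum fun k _ => hc k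
    rw [aux_sum_cong γ Ml m hm] at h1
    simp at h1
    linarith
  obtain ⟨k, hk⟩ := hk
  have hl : ∃ l, 0 < m l j := by
    by_contra! hc
    apply hj
    have : cong γ m j = 0 := by
      unfold cong
      refine Finset.sum_eq_zero fun l _ => ?_
      rw [le_antisymm (hc l) (hm.1 l j), mul_zero]
    rw [this]
    exact one_pos
  obtain ⟨l, hl⟩ := hl
  have := hNE l j k hl
  simp [cd, hj, hk] at this

theorem aux_ne {L N : Type*} [Fintype L]
    (σ2 : ℝ) (hσ : 0 < σ2) (γ : L → ℝ) (hγ : ∀ l, 0 < γ l)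
    (h : L → N → ℝ) (hh : ∀ l j, 0 < h l j)
    (m : L → N → ℝ) (hlt : ∀ j, cong γ m j < 1) (hNE : IsNE σ2 γ h m)
    (l : L) (j k : N) (hl : 0 < m l j) :
    h l k * (1 - cong γ m k) ≤ h l j * (1 - cong γ m j) := by
  have h1 := hNE l j k hl
  have hj : 0 < 1 - cong γ m j := sub_pos.2 (hlt j)
  have hk : 0 < 1 - cong γ m k := sub_pos.2 (hlt k)
  have hgs : 0 < γ l * σ2 := mul_pos (hγ l) hσ
  have pj := mul_pos (hh l j) hj
  have pk := mul_pos (hh l k) hk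
  simp only [cd, hlt, if_true, gq, div_div] at h1
  rw [ENNReal.ofReal_le_ofReal_iff (div_pos hgs pk).le,
    div_le_div_iff_of_pos_left hgs pj pk] at h1
  exact h1

theorem aux_le {L N : Type*} [Fintype L] [Fintype N]
    (γ Ml : L → ℝ) (hγ : ∀ l, 0 < γ l)
    (h : L → N → ℝ) (hh : ∀ l j, 0 < h l j)
    (m m' : L → N → ℝ) (hm : IsProfile Ml m) (hm' : IsProfile Ml m')
    (h1 : ∀ l j k, 0 < m l j → h l k * (1 - cong γ m k) ≤ h l j * (1 - cong γ m j))
    (h2 : ∀ l j k, 0 < m' l j → h l k * (1 - cong γ m' k) ≤ h l j * (1 - cong γ m' j))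
    (j : N) : cong γ m' j ≤ cong γ m j := by
  classical
  by_contra! hj
  set S : Finset N := Finset.univ.filter fun j => cong γ m j < cong γ m' j with hS
  have hjS : j ∈ S := by simp [hS, hj]
  have hlt : ∑ i ∈ S, cong γ m i < ∑ i ∈ S, cong γ m' i :=
    Finset.sum_lt_sum_of_nonempty ⟨j, hjS⟩ fun i hi => (Finset.mem_filter.1 hi).2
  have key : ∀ l, ∑ i ∈ S, m' l i ≤ ∑ i ∈ S, m l i := by
    intro l
    by_cases hex : ∃ i ∈ S, 0 < m' l i
    · obtain ⟨i, hi, hpos⟩ := hex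
      have hi' := (Finset.mem_filter.1 hi).2
      have hz : ∀ k, k ∉ S → m l k = 0 := by
        intro k hk
        by_contra hne
        have hp : 0 < m l k := lt_of_le_of_ne (hm.1 l k) (Ne.symm hne)
        have hk' : cong γ m' k ≤ cong γ m k := by simpa [hS] using hk
        have e1 := h1 l k i hp
        have e2 := h2 l i k hpos
        have e3 := mul_pos (hh l i) (sub_pos.2 hi')
        have e4 := mul_nonneg (hh l k).le (sub_nonneg.2 hk')
        nlinarith
      have e : ∑ i ∈ S, m l i = Ml l := by
        rw [← hm.2 l]
        exact Finset.sum_subset (Finset.subset_univ S) fun k _ hk => hz k hk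
      rw [e, ← hm'.2 l]
      exact Finset.sum_le_sum_of_subset_of_nonneg (Finset.subset_univ S) fun k _ _ => hm'.1 l k
    · push Not at hex
      exact Finset.sum_le_sum fun i hi => (hex i hi).trans (hm.1 l i)
  have hge : ∑ i ∈ S, cong γ m' i ≤ ∑ i ∈ S, cong γ m i := by
    unfold cong
    rw [Finset.sum_comm, Finset.sum_comm (s := S)]
    refine Finset.sum_le_sum fun l _ => ?_
    rw [← Finset.mul_sum, ← Finset.mul_sum]
    exact mul_le_mul_of_nonneg_left (key l) (hγ l).le
  linarith

/-- Under feasibility `∑_l γ_l M_l < |N|`: any two Nash equilibria of the nonatomic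
association game have the same congestion at each base station and give each class the
same equilibrium cost density. -/
theorem nonatomic_ne_congestion_unique {L N : Type*} [Fintype L] [Fintype N]
    (σ2 : ℝ) (hσ : 0 < σ2) (γ Ml : L → ℝ) (hγ : ∀ l, 0 < γ l) (hMl : ∀ l, 0 < Ml l)
    (h : L → N → ℝ) (hh : ∀ l j, 0 < h l j)
    (hfeas : (∑ l, γ l * Ml l) < Fintype.card N)
    (m m' : L → N → ℝ) (hm : IsProfile Ml m) (hm' : IsProfile Ml m')
    (hNE : IsNE σ2 γ h m) (hNE' : IsNE σ2 γ h m') :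
    (∀ j, cong γ m j = cong γ m' j) ∧
    (∀ (l : L) (j k : N), 0 < m l j → 0 < m' l k →
      cd σ2 γ h m l j = cd σ2 γ h m' l k) := by
  have a := aux_lt_one σ2 γ Ml h hfeas m hm hNE
  have a' := aux_lt_one σ2 γ Ml h hfeas m' hm' hNE'
  have b := aux_ne σ2 hσ γ hγ h hh m a hNE
  have b' := aux_ne σ2 hσ γ hγ h hh m' a' hNE'
  have c : ∀ j, cong γ m j = cong γ m' j := fun j =>
    le_antisymm (aux_le γ Ml hγ h hh m' m hm' hm b' b j)
      (aux_le γ Ml hγ h hh m m' hm hm' b b' j)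
  have d : ∀ l j, cd σ2 γ h m l j = cd σ2 γ h m' l j := by
    intro l j
    simp only [cd, c]
  refine ⟨c, fun l j k hj hk => le_antisymm ?_ ?_⟩
  · rw [← d l k]
    exact hNE l j k hj
  · rw [d l j]
    exact hNE' l k j hk
end

section
/- Assume Σ_{l=1}^L γ_l M_l < |N|. Define tolls t_{lj}(m) = γ_l Σ_{i=1}^L m_{ij} g_{ij} / (1 − m_j)² and tolled cost densities c̄_{lj}(m) = c_{lj}(m) + t_{lj}(m) on the region where m_j < 1 for all j. Then: (i) the system cost C(m) = Σ_{j ∈ N} Σ_{l=1}^L m_{lj} g_{lj}/(1 − m_j) is continuously differentiable on this region with ∂C(m)/∂m_{lj} = c̄_{lj}(m) for all l, j (so C is a potential function for the tolled game); and (ii) every system optimal congestion profile (a minimizer of C over all congestion profiles) is a Nash equilibrium of the tolled game, i.e., m_{lj} > 0 implies c̄_{lj}(m) ≤ c̄_{lk}(m) for all k. -/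
open scoped BigOperators ENNReal

/-- Real-valued system cost `C(m) = ∑_j ∑_l m_{lj} g_{lj}/(1 − m_j)` (used on the region
where `m_j < 1` for all `j`). -/
noncomputable def Creal {L N : Type*} [Fintype L] [Fintype N]
    (σ2 : ℝ) (γ : L → ℝ) (h : L → N → ℝ) (m : L → N → ℝ) : ℝ :=
  ∑ j, ∑ l, m l j * gq σ2 γ h l j / (1 - cong γ m j)

/-- System cost with values in `ℝ≥0∞`: `+∞` as soon as some base station `j` has
`m_j ≥ 1` and carries positive mass. -/
noncomputable def CsysE {L N : Type*} [Fintype L] [Fintype N]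
    (σ2 : ℝ) (γ : L → ℝ) (h : L → N → ℝ) (m : L → N → ℝ) : ℝ≥0∞ :=
  ∑ j, ∑ l, ENNReal.ofReal (m l j) * cd σ2 γ h m l j

/-- Tolled cost density `c̄_{lj}(m) = c_{lj}(m) + t_{lj}(m)` with toll
`t_{lj}(m) = γ_l ∑_i m_{ij} g_{ij}/(1 − m_j)²`, as a real number on the region where
`m_j < 1`. -/
noncomputable def cbarR {L N : Type*} [Fintype L]
    (σ2 : ℝ) (γ : L → ℝ) (h : L → N → ℝ) (m : L → N → ℝ) (l : L) (j : N) : ℝ :=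
  gq σ2 γ h l j / (1 - cong γ m j) +
    γ l * (∑ i, m i j * gq σ2 γ h i j) / (1 - cong γ m j) ^ 2

theorem hasDerivAt_Creal_curve {L N : Type*} [Fintype L] [Fintype N]
    (σ2 : ℝ) (γ : L → ℝ) (h : L → N → ℝ) (m : ℝ → L → N → ℝ) (d : L → N → ℝ) (t0 : ℝ)
    (hm : ∀ l j, HasDerivAt (fun t => m t l j) (d l j) t0)
    (hc : ∀ j, cong γ (m t0) j < 1) :
    HasDerivAt (fun t => Creal σ2 γ h (m t))
      (∑ j, ∑ l, d l j * cbarR σ2 γ h (m t0) l j) t0 := by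
  unfold Creal
  apply HasDerivAt.fun_sum
  intro j _
  have hne : (1 - cong γ (m t0) j) ≠ 0 := by have := hc j; linarith
  have hcong : HasDerivAt (fun t => cong γ (m t) j) (∑ l, γ l * d l j) t0 := by
    unfold cong
    apply HasDerivAt.fun_sum
    intro l _
    exact (hm l j).const_mul _
  have hnum : HasDerivAt (fun t => ∑ l, m t l j * gq σ2 γ h l j)
      (∑ l, d l j * gq σ2 γ h l j) t0 := by
    apply HasDerivAt.fun_sum
    intro l _
    exact (hm l j).mul_const _
  have key := hnum.fun_div (hcong.const_sub 1) hne
  have e1 : (fun t => ∑ l, m t l j * gq σ2 γ h l j / (1 - cong γ (m t) j))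
      = fun t => (∑ l, m t l j * gq σ2 γ h l j) / (1 - cong γ (m t) j) := by
    funext t
    rw [Finset.sum_div]
  rw [e1]
  refine HasDerivAt.congr_deriv key (Eq.symm ?_)
  have e2 : ∀ l, d l j * cbarR σ2 γ h (m t0) l j =
      (d l j * gq σ2 γ h l j) * (1 / (1 - cong γ (m t0) j)) +
      (γ l * d l j) * ((∑ i, m t0 i j * gq σ2 γ h i j) / (1 - cong γ (m t0) j) ^ 2) := by
    intro l
    unfold cbarR
    ring
  simp only [e2]
  rw [Finset.sum_add_distrib, ← Finset.sum_mul, ← Finset.sum_mul]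
  field_simp
  ring

theorem CsysE_eq {L N : Type*} [Fintype L] [Fintype N]
    (σ2 : ℝ) (hσ : 0 < σ2) (γ : L → ℝ) (hγ : ∀ l, 0 < γ l)
    (h : L → N → ℝ) (hh : ∀ l j, 0 < h l j) (m : L → N → ℝ) (hm : ∀ l j, 0 ≤ m l j)
    (hc : ∀ j, cong γ m j < 1) :
    CsysE σ2 γ h m = ENNReal.ofReal (Creal σ2 γ h m) ∧ 0 ≤ Creal σ2 γ h m := by
  have hg : ∀ l j, 0 ≤ gq σ2 γ h l j := fun l j =>
    div_nonneg (mul_nonneg (hγ l).le hσ.le) (hh l j).le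
  have hp : ∀ j l, 0 ≤ m l j * gq σ2 γ h l j / (1 - cong γ m j) := fun j l =>
    div_nonneg (mul_nonneg (hm l j) (hg l j)) (by have := hc j; linarith)
  have hs : ∀ j, 0 ≤ ∑ l, m l j * gq σ2 γ h l j / (1 - cong γ m j) := fun j =>
    Finset.sum_nonneg fun l _ => hp j l
  refine ⟨?_, Finset.sum_nonneg fun j _ => hs j⟩
  unfold CsysE Creal
  rw [ENNReal.ofReal_sum_of_nonneg (fun j _ => hs j)]
  refine Finset.sum_congr rfl fun j _ => ?_
  rw [ENNReal.ofReal_sum_of_nonneg (fun l _ => hp j l)]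
  refine Finset.sum_congr rfl fun l _ => ?_
  rw [cd, if_pos (hc j), ← ENNReal.ofReal_mul (hm l j), mul_div_assoc]

theorem optimal_cong_lt {L N : Type*} [Fintype L] [Fintype N]
    (σ2 : ℝ) (hσ : 0 < σ2) (γ Ml : L → ℝ) (hγ : ∀ l, 0 < γ l) (hMl : ∀ l, 0 < Ml l)
    (h : L → N → ℝ) (hh : ∀ l j, 0 < h l j)
    (hfeas : (∑ l, γ l * Ml l) < Fintype.card N) (m : L → N → ℝ) (hm : IsProfile Ml m)
    (hopt : ∀ m' : L → N → ℝ, IsProfile Ml m' → CsysE σ2 γ h m ≤ CsysE σ2 γ h m') (j : N) :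
    cong γ m j < 1 := by
  have hN : (0 : ℝ) < Fintype.card N :=
    lt_of_le_of_lt (Finset.sum_nonneg fun l _ => (mul_pos (hγ l) (hMl l)).le) hfeas
  let u : L → N → ℝ := fun l _ => Ml l / Fintype.card N
  have hu0 : ∀ l j, 0 ≤ u l j := fun l j => div_nonneg (hMl l).le hN.le
  have hu : IsProfile Ml u := by
    refine ⟨hu0, fun l => ?_⟩
    simp only [u, Finset.sum_const, Finset.card_univ, nsmul_eq_mul]
    field_simp
  have huc : ∀ j, cong γ u j < 1 := by
    intro j
    have : cong γ u j = (∑ l, γ l * Ml l) / Fintype.card N := by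
      unfold cong
      rw [Finset.sum_div]
      exact Finset.sum_congr rfl fun l _ => by simp only [u]; ring
    rw [this, div_lt_one hN]
    exact hfeas
  have hfin : CsysE σ2 γ h m ≠ ⊤ := by
    have h1 := hopt u hu
    rw [(CsysE_eq σ2 hσ γ hγ h hh u hu0 huc).1] at h1
    exact ne_top_of_le_ne_top ENNReal.ofReal_ne_top h1
  by_contra hj
  have hpos : ∃ l, 0 < m l j := by
    by_contra hno
    push Not at hno
    apply hj
    have : cong γ m j ≤ 0 := Finset.sum_nonpos fun l _ =>
      mul_nonpos_of_nonneg_of_nonpos (hγ l).le (hno l)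
    linarith
  obtain ⟨l, hl⟩ := hpos
  apply hfin
  unfold CsysE
  rw [ENNReal.sum_eq_top]
  refine ⟨j, Finset.mem_univ _, ?_⟩
  rw [ENNReal.sum_eq_top]
  refine ⟨l, Finset.mem_univ _, ?_⟩
  rw [cd, if_neg hj, ENNReal.mul_top]
  simpa using hl

theorem deriv_nonneg_of_right_min (f : ℝ → ℝ) (f' : ℝ) (hf : HasDerivAt f f' 0)
    (hmin : ∀ᶠ t in nhdsWithin (0 : ℝ) (Set.Ioi 0), f 0 ≤ f t) : 0 ≤ f' := by
  have h1 := (hasDerivWithinAt_iff_tendsto_slope' (s := Set.Ioi (0 : ℝ)) (by simp)).1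
    hf.hasDerivWithinAt
  refine ge_of_tendsto h1 ?_
  filter_upwards [hmin, self_mem_nhdsWithin] with t ht ht0
  rw [slope_def_field]
  have : (0 : ℝ) < t := ht0
  exact div_nonneg (by linarith) (by linarith)

/-- Under feasibility `∑_l γ_l M_l < |N|`: (i) the system cost is continuously
differentiable on the region `{m | m_j < 1 ∀ j}` with partial derivatives
`∂C/∂m_{lj} = c̄_{lj}(m)`, so `C` is a potential for the tolled game; (ii) every system
optimal congestion profile is a Nash equilibrium of the tolled game. -/
theorem nonatomic_tolls_weakly_enforce {L N : Type*}
    [Fintype L] [DecidableEq L] [Fintype N] [DecidableEq N]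
    (σ2 : ℝ) (hσ : 0 < σ2) (γ Ml : L → ℝ) (hγ : ∀ l, 0 < γ l) (hMl : ∀ l, 0 < Ml l)
    (h : L → N → ℝ) (hh : ∀ l j, 0 < h l j)
    (hfeas : (∑ l, γ l * Ml l) < Fintype.card N) :
    (ContDiffOn ℝ 1 (Creal σ2 γ h) {m : L → N → ℝ | ∀ j, cong γ m j < 1} ∧
      ∀ m : L → N → ℝ, (∀ j, cong γ m j < 1) → ∀ (l : L) (j : N),
        HasDerivAt (fun t : ℝ => Creal σ2 γ h (Function.update m l (Function.update (m l) j t)))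
          (cbarR σ2 γ h m l j) (m l j)) ∧
    (∀ m : L → N → ℝ, IsProfile Ml m →
      (∀ m' : L → N → ℝ, IsProfile Ml m' → CsysE σ2 γ h m ≤ CsysE σ2 γ h m') →
      (∀ j, cong γ m j < 1) ∧
      ∀ (l : L) (j k : N), 0 < m l j → cbarR σ2 γ h m l j ≤ cbarR σ2 γ h m l k) := by
  refine ⟨⟨?_, ?_⟩, ?_⟩
  · unfold Creal
    refine ContDiffOn.sum fun j _ => ContDiffOn.sum fun l _ => ?_
    have hcong : ContDiff ℝ 1 (fun m : L → N → ℝ => cong γ m j) := by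
      unfold cong
      fun_prop
    refine ContDiffOn.div ?_ ?_ ?_
    · fun_prop
    · exact (contDiff_const.sub hcong).contDiffOn
    · intro m hm
      have : cong γ m j < 1 := hm j
      linarith
  · intro m hm l j
    have hself : Function.update m l (Function.update (m l) j (m l j)) = m := by simp
    have key := hasDerivAt_Creal_curve σ2 γ h
      (fun t => Function.update m l (Function.update (m l) j t))
      (fun a b => if a = l then (if b = j then 1 else 0) else 0) (m l j) ?_ ?_
    · simp only [hself] at key
      simpa using key
    · intro a b
      by_cases ha : a = l
      · subst ha
        by_cases hb : b = j
        · subst hb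
          simpa using hasDerivAt_id' (m a b)
        · simpa [hb] using hasDerivAt_const (m a j) (m a b)
      · simpa [ha] using hasDerivAt_const (m l j) (m a b)
    · simpa only [hself] using hm
  · intro m hm hopt
    have hc := optimal_cong_lt σ2 hσ γ Ml hγ hMl h hh hfeas m hm hopt
    refine ⟨hc, ?_⟩
    intro l j k hlj
    by_cases hjk : j = k
    · rw [hjk]
    let d : L → N → ℝ := fun a b =>
      if a = l then ((if b = k then 1 else 0) - (if b = j then 1 else 0)) else 0
    let p : ℝ → L → N → ℝ := fun t a b => m a b + t * d a b
    have hp0 : p 0 = m := by funext a b; simp [p]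
    have key := hasDerivAt_Creal_curve σ2 γ h p d 0
      (fun a b => by
        simpa [p] using ((hasDerivAt_id (0 : ℝ)).mul_const (d a b)).const_add (m a b))
      (by rw [hp0]; exact hc)
    have hval : (∑ b, ∑ a, d a b * cbarR σ2 γ h (p 0) a b)
        = cbarR σ2 γ h m l k - cbarR σ2 γ h m l j := by
      rw [hp0]
      simp [d, sub_mul, Finset.sum_sub_distrib]
    rw [hval] at key
    have := deriv_nonneg_of_right_min _ _ key ?_
    · linarith
    have hcont : ∀ b, Continuous fun t => cong γ (p t) b := by
      intro b
      simp only [cong, p]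
      fun_prop
    have hev : ∀ᶠ t in nhdsWithin (0 : ℝ) (Set.Ioi 0), ∀ b, cong γ (p t) b < 1 := by
      refine Filter.Eventually.filter_mono nhdsWithin_le_nhds ?_
      rw [Filter.eventually_all]
      intro b
      exact (hcont b).continuousAt.eventually_lt continuousAt_const (by rw [hp0]; exact hc b)
    have hev2 : ∀ᶠ t in nhdsWithin (0 : ℝ) (Set.Ioi 0), t < m l j :=
      Filter.Eventually.filter_mono nhdsWithin_le_nhds (eventually_lt_nhds hlj)
    filter_upwards [hev, hev2, self_mem_nhdsWithin] with t ht1 ht2 ht3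
    have ht0 : (0 : ℝ) < t := ht3
    have hprof : IsProfile Ml (p t) := by
      constructor
      · intro a b
        have hab := hm.1 a b
        simp only [p, d]
        by_cases ha : a = l
        · subst ha
          by_cases hb : b = j
          · subst hb
            simp [hjk]
            linarith
          · simp [hb]
            split_ifs <;> linarith
        · simpa [ha] using hab
      · intro a
        simp only [p, d]
        rw [Finset.sum_add_distrib, hm.2 a, ← Finset.mul_sum]
        by_cases ha : a = l <;> simp [ha]
    have h1 := hopt _ hprof
    rw [(CsysE_eq σ2 hσ γ hγ h hh m hm.1 hc).1] at h1
    have h2 := CsysE_eq σ2 hσ γ hγ h hh (p t) hprof.1 ht1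
    rw [h2.1, ENNReal.ofReal_le_ofReal_iff h2.2] at h1
    simpa only [hp0] using h1
end

section
/- Suppose all mobiles are collocated with single class traffic: h_{ij} = h_j > 0 and β_i = β ∈ (0,1) for all i ∈ M, j ∈ N, and suppose at least one association profile gives every mobile finite cost. Consider the tolled game with costs c̄_i(a) = Σ_{l ∈ M_{a_i}(a)} (σ² β / h_{a_i}) / (1 − |M_{a_i}(a)| β) − Σ_{l ∈ M_{a_i}(a)∖{i}} (σ² β / h_{a_i}) / (1 − (|M_{a_i}(a)| − 1) β) (with the convention that a term is +∞ when its denominator is nonpositive, the first dominating). Then every Nash equilibrium a of the tolled game is system optimal: it minimizes the system cost C(a) = Σ_{i ∈ M} c_i(a) over all association profiles. In other words, the tolls strongly enforce system optimality in this case. -/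
open scoped BigOperators ENNReal

/-- Number of mobiles associated with base station `j` under profile `a`. -/
def mcount {M N : Type*} [Fintype M] [DecidableEq N] (a : M → N) (j : N) : ℕ :=
  (Finset.univ.filter (fun l => a l = j)).card

/-- Cost of mobile `i` under profile `a` for single class traffic (common load `β`) and
collocated mobiles (gain `hb j` to base station `j`):
`(σ²β/h_{a_i})/(1 − |M_{a_i}(a)|β)` when `|M_{a_i}(a)|β < 1`, else `+∞`. -/
noncomputable def mcost {M N : Type*} [Fintype M] [DecidableEq N]
    (σ2 β : ℝ) (hb : N → ℝ) (a : M → N) (i : M) : ℝ≥0∞ :=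
  if (mcount a (a i) : ℝ) * β < 1 then
    ENNReal.ofReal (σ2 * β / hb (a i) / (1 - (mcount a (a i) : ℝ) * β))
  else ⊤

/-- System cost `C(a) = ∑_i c_i(a)`. -/
noncomputable def sysCost {M N : Type*} [Fintype M] [DecidableEq N]
    (σ2 β : ℝ) (hb : N → ℝ) (a : M → N) : ℝ≥0∞ :=
  ∑ i, mcost σ2 β hb a i

/-- Tolled cost of mobile `i` under profile `a`:
`|M_{a_i}(a)|(σ²β/h_{a_i})/(1 − |M_{a_i}(a)|β) −
 (|M_{a_i}(a)| − 1)(σ²β/h_{a_i})/(1 − (|M_{a_i}(a)| − 1)β)`,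
equal to `+∞` when the first term's denominator is nonpositive (the first
term dominating). -/
noncomputable def tolledCost {M N : Type*} [Fintype M] [DecidableEq N]
    (σ2 β : ℝ) (hb : N → ℝ) (a : M → N) (i : M) : ℝ≥0∞ :=
  if (mcount a (a i) : ℝ) * β < 1 then
    ENNReal.ofReal
      ((mcount a (a i) : ℝ) * (σ2 * β / hb (a i)) / (1 - (mcount a (a i) : ℝ) * β) -
        ((mcount a (a i) : ℝ) - 1) * (σ2 * β / hb (a i)) /
          (1 - ((mcount a (a i) : ℝ) - 1) * β))
  else ⊤

lemma mcount_update_aux {M N : Type*} [Fintype M] [DecidableEq M] [DecidableEq N]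
    (a : M → N) (i : M) (k : N) (hk : a i ≠ k) :
    mcount (Function.update a i k) k = mcount a k + 1 := by
  unfold mcount
  have : (Finset.univ.filter (fun l => Function.update a i k l = k))
      = insert i (Finset.univ.filter (fun l => a l = k)) := by
    ext l
    by_cases h : l = i
    · subst h; simp
    · simp [h]
  rw [this, Finset.card_insert_of_notMem]
  simpa using hk

lemma sum_mcount_aux {M N : Type*} [Fintype M] [Fintype N] [DecidableEq N]
    (a : M → N) (g : N → ℝ) :
    ∑ i, g (a i) = ∑ j, (mcount a j : ℝ) * g j := by
  rw [← Finset.sum_fiberwise Finset.univ a]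
  refine Finset.sum_congr rfl fun j _ => ?_
  rw [Finset.sum_congr rfl (g := fun _ => g j)]
  · simp [mcount]
  · intro x hx
    simp at hx
    rw [hx]

lemma total_mcount_aux {M N : Type*} [Fintype M] [Fintype N] [DecidableEq N]
    (a : M → N) : ∑ j, mcount a j = Fintype.card M := by
  have := sum_mcount_aux a (fun _ => 1)
  simp at this
  exact_mod_cast this.symm

lemma mcount_pos_aux {M N : Type*} [Fintype M] [DecidableEq N]
    (a : M → N) (j : N) (h : 0 < mcount a j) : ∃ i, a i = j := by
  obtain ⟨i, hi⟩ := Finset.card_pos.mp h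
  exact ⟨i, by simpa using hi⟩

lemma feas_aux {M N : Type*} [Fintype M] [DecidableEq N] (β : ℝ) (a : M → N)
    (h : ∀ i, (mcount a (a i) : ℝ) * β < 1) (j : N) : (mcount a j : ℝ) * β < 1 := by
  rcases Nat.eq_zero_or_pos (mcount a j) with h0 | h0
  · simp [h0]
  · obtain ⟨i, rfl⟩ := mcount_pos_aux a j h0
    exact h i

lemma sysCost_aux {M N : Type*} [Fintype M] [Fintype N] [DecidableEq N]
    (σ2 : ℝ) (hσ : 0 < σ2) (β : ℝ) (hβ0 : 0 < β)
    (hb : N → ℝ) (hhb : ∀ j, 0 < hb j) (a : M → N)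
    (h : ∀ i, (mcount a (a i) : ℝ) * β < 1) :
    sysCost σ2 β hb a = ENNReal.ofReal
      (∑ j, (mcount a j : ℝ) * (σ2 * β / hb j / (1 - (mcount a j : ℝ) * β))) := by
  rw [← sum_mcount_aux a (fun j => σ2 * β / hb j / (1 - (mcount a j : ℝ) * β)),
    ENNReal.ofReal_sum_of_nonneg]
  · unfold sysCost mcost
    exact Finset.sum_congr rfl fun i _ => if_pos (h i)
  · intro i _
    have := hhb (a i)
    have := h i
    have : 0 < 1 - (mcount a (a i) : ℝ) * β := by linarith
    positivity

/-- closed form of the marginal cost -/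
noncomputable def margAux (c β x : ℝ) : ℝ := c / ((1 - x * β) * (1 - (x - 1) * β))

lemma marg_eq_aux (c β x : ℝ) (hβ0 : 0 < β) (hx : x * β < 1) :
    x * c / (1 - x * β) - (x - 1) * c / (1 - (x - 1) * β) = margAux c β x := by
  have h1 : 1 - x * β ≠ 0 := by nlinarith
  have h2 : 1 - (x - 1) * β ≠ 0 := by nlinarith
  unfold margAux
  rw [div_sub_div _ _ h1 h2]
  congr 1
  ring

lemma marg_pos_aux (c β x : ℝ) (hc : 0 < c) (hβ0 : 0 < β) (hx : x * β < 1) :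
    0 < margAux c β x := by
  have h1 : 0 < 1 - x * β := by nlinarith
  have h2 : 0 < 1 - (x - 1) * β := by nlinarith
  unfold margAux
  positivity

lemma diff_aux (c β m n : ℝ) (hm : m * β < 1) (hn : n * β < 1) :
    m * (c / (1 - m * β)) - n * (c / (1 - n * β)) =
      (m - n) * (c / ((1 - m * β) * (1 - n * β))) := by
  have h1 : 1 - m * β ≠ 0 := by linarith
  have h2 : 1 - n * β ≠ 0 := by linarith
  rw [← mul_div_assoc, ← mul_div_assoc, ← mul_div_assoc, div_sub_div _ _ h1 h2]
  congr 1
  ring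

/-- Collocated mobiles with single class traffic (`h_{ij} = h_j`, `β_i = β`): every Nash
equilibrium of the tolled game is system optimal, i.e., the tolls strongly enforce
system optimality. -/
theorem tolls_strongly_enforce_collocated_single_class {M N : Type*}
    [Fintype M] [DecidableEq M] [Fintype N] [DecidableEq N]
    (σ2 : ℝ) (hσ : 0 < σ2) (β : ℝ) (hβ0 : 0 < β) (hβ1 : β < 1)
    (hb : N → ℝ) (hhb : ∀ j, 0 < hb j)
    (hfeas : ∃ a₀ : M → N, ∀ i, mcost σ2 β hb a₀ i < ⊤)
    (a : M → N)
    (hNE : ∀ (i : M) (j : N),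
      tolledCost σ2 β hb a i ≤ tolledCost σ2 β hb (Function.update a i j) i) :
    ∀ a' : M → N, sysCost σ2 β hb a ≤ sysCost σ2 β hb a' := by
  classical
  intro a'
  have hc : ∀ j, 0 < σ2 * β / hb j := fun j => by have := hhb j; positivity
  have key : ∀ i k, a i ≠ k → ((mcount a k : ℝ) + 1) * β < 1 →
      (mcount a (a i) : ℝ) * β < 1 ∧
        margAux (σ2 * β / hb (a i)) β (mcount a (a i)) ≤
          margAux (σ2 * β / hb k) β ((mcount a k : ℝ) + 1) := by
    intro i k hik hk
    have h := hNE i k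
    unfold tolledCost at h
    rw [Function.update_self, mcount_update_aux a i k hik] at h
    push_cast at h
    rw [if_pos hk] at h
    by_cases hi : (mcount a (a i) : ℝ) * β < 1
    · refine ⟨hi, ?_⟩
      rw [if_pos hi, marg_eq_aux _ _ _ hβ0 hi, marg_eq_aux _ _ _ hβ0 hk] at h
      exact (ENNReal.ofReal_le_ofReal_iff (marg_pos_aux _ _ _ (hc k) hβ0 hk).le).mp h
    · rw [if_neg hi] at h
      simp at h
  have hfa : ∀ i, (mcount a (a i) : ℝ) * β < 1 := by
    by_contra! hcon
    obtain ⟨i, hi⟩ := hcon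
    obtain ⟨a₀, h₀⟩ := hfeas
    have hf₀ : ∀ l, (mcount a₀ (a₀ l) : ℝ) * β < 1 := by
      intro l
      by_contra hl
      have := h₀ l
      simp [mcost, hl] at this
    have hf := feas_aux β a₀ hf₀
    have hlt : ∑ j, mcount a₀ j < ∑ j, mcount a j := by
      apply Finset.sum_lt_sum
      · intro k _
        by_cases hk : a i = k
        · subst hk
          have := (hf (a i)).trans_le hi
          have := lt_of_mul_lt_mul_right this hβ0.le
          exact_mod_cast this.le
        · have h1 : 1 ≤ ((mcount a k : ℝ) + 1) * β := by
            by_contra! h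
            exact absurd (key i k hk h).1 (not_lt.mpr hi)
          have := lt_of_mul_lt_mul_right ((hf k).trans_le h1) hβ0.le
          have h2 : mcount a₀ k < mcount a k + 1 := by exact_mod_cast this
          omega
      · refine ⟨a i, Finset.mem_univ _, ?_⟩
        have := lt_of_mul_lt_mul_right ((hf (a i)).trans_le hi) hβ0.le
        exact_mod_cast this
    rw [total_mcount_aux, total_mcount_aux] at hlt
    exact lt_irrefl _ hlt
  by_cases hfa' : ∀ i, (mcount a' (a' i) : ℝ) * β < 1
  swap
  · push Not at hfa'
    obtain ⟨i, hi⟩ := hfa'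
    have : sysCost σ2 β hb a' = ⊤ := by
      unfold sysCost
      rw [ENNReal.sum_eq_top]
      exact ⟨i, Finset.mem_univ _, by simp [mcost, not_lt.mpr hi]⟩
    rw [this]
    exact le_top
  rw [sysCost_aux σ2 hσ β hβ0 hb hhb a hfa, sysCost_aux σ2 hσ β hβ0 hb hhb a' hfa']
  apply ENNReal.ofReal_le_ofReal
  have hn := feas_aux β a hfa
  have hm := feas_aux β a' hfa'
  rcases isEmpty_or_nonempty M with hM | hM
  · simp [mcount]
  obtain ⟨i₀, hi₀⟩ := Finite.exists_max
    (fun i => margAux (σ2 * β / hb (a i)) β (mcount a (a i)))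
  set L := margAux (σ2 * β / hb (a i₀)) β (mcount a (a i₀)) with hL
  have hstep : ∀ j, ((mcount a' j : ℝ) - mcount a j) * L ≤
      (mcount a' j : ℝ) * (σ2 * β / hb j / (1 - (mcount a' j : ℝ) * β)) -
      (mcount a j : ℝ) * (σ2 * β / hb j / (1 - (mcount a j : ℝ) * β)) := by
    intro j
    rw [diff_aux _ _ _ _ (hm j) (hn j)]
    have hcj := hc j
    have hmj : 0 < 1 - (mcount a' j : ℝ) * β := by linarith [hm j]
    have hnj : 0 < 1 - (mcount a j : ℝ) * β := by linarith [hn j]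
    rcases lt_trichotomy (mcount a' j) (mcount a j) with hlt | heq | hgt
    · have hle : (mcount a' j : ℝ) + 1 ≤ mcount a j := by exact_mod_cast hlt
      apply mul_le_mul_of_nonpos_left _ (by linarith)
      obtain ⟨i, rfl⟩ := mcount_pos_aux a j (by omega)
      refine le_trans ?_ (hi₀ i)
      show _ ≤ margAux _ _ _
      unfold margAux
      rw [mul_comm (1 - (mcount a' (a i) : ℝ) * β)]
      have : 0 < 1 - ((mcount a (a i) : ℝ) - 1) * β := by nlinarith
      gcongr
      linarith
    · simp [heq]
    · have hle : (mcount a j : ℝ) + 1 ≤ mcount a' j := by exact_mod_cast hgt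
      apply mul_le_mul_of_nonneg_left _ (by linarith)
      have h1 : ((mcount a j : ℝ) + 1) * β < 1 := by nlinarith
      have h1' : 0 < 1 - ((mcount a j : ℝ) + 1) * β := by linarith
      have h2 : margAux (σ2 * β / hb j) β ((mcount a j : ℝ) + 1) ≤
          σ2 * β / hb j / ((1 - (mcount a' j : ℝ) * β) * (1 - (mcount a j : ℝ) * β)) := by
        unfold margAux
        rw [add_sub_cancel_right]
        gcongr
      refine le_trans ?_ h2
      by_cases hj : a i₀ = j
      · rw [hL, hj]
        unfold margAux
        rw [add_sub_cancel_right, mul_comm (1 - (mcount a j : ℝ) * β)]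
        have : 0 < 1 - ((mcount a j : ℝ) - 1) * β := by nlinarith
        rw [mul_comm (1 - ((mcount a j : ℝ) - 1) * β)]
        rw [mul_comm (1 - ((mcount a j : ℝ) + 1) * β)]
        gcongr
        linarith
      · exact (key i₀ j hj h1).2
  have hsum := Finset.sum_le_sum (fun j (_ : j ∈ Finset.univ) => hstep j)
  rw [← Finset.sum_mul, Finset.sum_sub_distrib, Finset.sum_sub_distrib] at hsum
  have e1 : ∑ j, (mcount a' j : ℝ) = Fintype.card M := by exact_mod_cast total_mcount_aux a'
  have e2 : ∑ j, (mcount a j : ℝ) = Fintype.card M := by exact_mod_cast total_mcount_aux a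
  rw [e1, e2, sub_self, zero_mul] at hsum
  linarith
end
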